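/- arXiv:nlin/0611024 — 11 statements merged into one kernel-verified Lean document; each statement's English description precedes it below -/
import Mathlib

section
/- Assume σ > 1 > τ > 0, 0 < η < η_c, α² = π²/2, l = 1 and λ = λ_c. Then the characteristic cubic f has three simple real zeros, i.e. three pairwise distinct real roots, one of which is 0. -/
/-- `γ² = α² + l²π²` where `αsq = α²` is the squared horizontal wave number. -/
noncomputable def gamSq (αsq : ℝ) (l : ℕ) : ℝ := αsq + (l : ℝ) ^ 2 * Real.pi ^ 2

/-- The characteristic cubic. -/
noncomputable def charCubic (σ τ lam η αsq : ℝ) (l : ℕ) (β : ℝ) : ℝ :=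
  β ^ 3 + (σ + τ + 1) * gamSq αsq l * β ^ 2
    + ((σ + τ + σ * τ) * (gamSq αsq l) ^ 2 - σ * αsq * (lam - η) / gamSq αsq l) * β
    + σ * τ * (gamSq αsq l) ^ 3 + σ * αsq * (η - τ * lam)

/-- A monic real quadratic with positive discriminant and nonzero constant term has two distinct
nonzero roots. -/
lemma exists_distinct_nonzero_roots {B C : ℝ} (hC : C ≠ 0) (hD : 0 < B ^ 2 - 4 * C) :
    ∃ x y : ℝ, x ≠ 0 ∧ y ≠ 0 ∧ x ≠ y ∧
      x ^ 2 + B * x + C = 0 ∧ y ^ 2 + B * y + C = 0 := by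
  have hs := Real.sqrt_pos.mpr hD
  have hs2 := Real.sq_sqrt hD.le
  set s := √(B ^ 2 - 4 * C)
  have hx : ((-B + s) / 2) ^ 2 + B * ((-B + s) / 2) + C = 0 := by linear_combination hs2 / 4
  have hy : ((-B - s) / 2) ^ 2 + B * ((-B - s) / 2) + C = 0 := by linear_combination hs2 / 4
  refine ⟨_, _, fun h => hC ?_, fun h => hC ?_, fun h => by linarith, hx, hy⟩
  · simpa [h] using hx
  · simpa [h] using hy

/-- At the critical wave number and `λ = λ_c` the characteristic cubic is `β` times a quadratic. -/
lemma charCubic_critical_eq_mul (σ η β : ℝ) {τ : ℝ} (hτ : τ ≠ 0) :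
    charCubic σ τ (η / τ + (27 / 4) * Real.pi ^ 4) η (Real.pi ^ 2 / 2) 1 β =
      β * (β ^ 2 + (σ + τ + 1) * (3 / 2 * Real.pi ^ 2) * β +
        (9 / 4 * Real.pi ^ 4 * τ * (1 + σ) - σ * η * (1 - τ) / (3 * τ))) := by
  have hπ := Real.pi_ne_zero
  have hγ : gamSq (Real.pi ^ 2 / 2) 1 = 3 / 2 * Real.pi ^ 2 := by
    simp only [gamSq, Nat.cast_one]; ring
  rw [charCubic, hγ]
  field_simp
  ring

/-- For `σ > 1 > τ > 0`, `0 < η < η_c`, `α² = π²/2`, `l = 1`, `λ = λ_c`, the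
characteristic cubic has three simple (pairwise distinct) real zeros, one of which is `0`. -/
theorem stmt_2 (σ τ lam η α : ℝ) (l : ℕ)
    (hσ : 1 < σ) (hτ0 : 0 < τ) (hτ1 : τ < 1)
    (hη0 : 0 < η)
    (hηc : η < (27 / 4) * Real.pi ^ 4 * τ ^ 2 * (1 + σ⁻¹) * (1 - τ)⁻¹)
    (hα : α ^ 2 = Real.pi ^ 2 / 2) (hl : l = 1)
    (hlam : lam = η / τ + (27 / 4) * Real.pi ^ 4) :
    ∃ b₂ b₃ : ℝ, b₂ ≠ 0 ∧ b₃ ≠ 0 ∧ b₂ ≠ b₃ ∧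
      charCubic σ τ lam η (α ^ 2) l 0 = 0 ∧
      charCubic σ τ lam η (α ^ 2) l b₂ = 0 ∧
      charCubic σ τ lam η (α ^ 2) l b₃ = 0 := by
  subst hl hlam
  have hσ0 : 0 < σ := by linarith
  have hτ' : 0 < 1 - τ := by linarith
  have hC : 0 < 9 / 4 * Real.pi ^ 4 * τ * (1 + σ) - σ * η * (1 - τ) / (3 * τ) := by
    have key := mul_lt_mul_of_pos_right hηc (show 0 < σ * (1 - τ) / (3 * τ) by positivity)
    have e : (27 / 4) * Real.pi ^ 4 * τ ^ 2 * (1 + σ⁻¹) * (1 - τ)⁻¹ * (σ * (1 - τ) / (3 * τ)) =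
        9 / 4 * Real.pi ^ 4 * τ * (1 + σ) := by
      field_simp
      ring
    rw [e] at key
    rw [sub_pos]
    calc σ * η * (1 - τ) / (3 * τ) = η * (σ * (1 - τ) / (3 * τ)) := by ring
      _ < _ := key
  have hD : 0 < ((σ + τ + 1) * (3 / 2 * Real.pi ^ 2)) ^ 2 -
      4 * (9 / 4 * Real.pi ^ 4 * τ * (1 + σ) - σ * η * (1 - τ) / (3 * τ)) := by
    have e : ((σ + τ + 1) * (3 / 2 * Real.pi ^ 2)) ^ 2 -
        4 * (9 / 4 * Real.pi ^ 4 * τ * (1 + σ) - σ * η * (1 - τ) / (3 * τ)) =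
        (3 / 2 * Real.pi ^ 2 * (σ + 1 - τ)) ^ 2 + 4 * (σ * η * (1 - τ) / (3 * τ)) := by ring
    rw [e]
    positivity
  obtain ⟨x, y, hx0, hy0, hxy, hx, hy⟩ := exists_distinct_nonzero_roots hC.ne' hD
  refine ⟨x, y, hx0, hy0, hxy, ?_, ?_, ?_⟩ <;>
    rw [hα, charCubic_critical_eq_mul _ _ _ hτ0.ne']
  · exact zero_mul _
  · rw [hx, mul_zero]
  · rw [hy, mul_zero]
end

section
/- Let σ, τ, η > 0, α² = π²/2, l = 1, and suppose λ > λ_c. Then the characteristic cubic f has a real root β > 0. -/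
/-- A monic real cubic with nonnegative quadratic and negative constant coefficient has a
positive root. -/
theorem exists_pos_root_cubic (a b c : ℝ) (ha : 0 ≤ a) (hc : c < 0) :
    ∃ x : ℝ, 0 < x ∧ x ^ 3 + a * x ^ 2 + b * x + c = 0 := by
  obtain ⟨M, hM⟩ : ∃ M, M = 1 + |b| - c := ⟨_, rfl⟩
  have hb := abs_nonneg b
  have hM1 : 1 ≤ M := by linarith
  have hM0 : 0 ≤ M := by linarith
  have hfM : 0 ≤ M ^ 3 + a * M ^ 2 + b * M + c := by
    have h1 : M * M ≤ M ^ 3 := by nlinarith [mul_nonneg hM0 hM0]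
    have h2 : M * M = M + |b| * M - c * M := by rw [hM]; ring
    have h3 : 0 ≤ (b + |b|) * M := mul_nonneg (by linarith [neg_abs_le b]) hM0
    have h4 : 0 ≤ a * M ^ 2 := by positivity
    nlinarith
  have hcont : ContinuousOn (fun x : ℝ => x ^ 3 + a * x ^ 2 + b * x + c) (Set.Icc 0 M) := by
    fun_prop
  obtain ⟨x, hx, hx0⟩ := intermediate_value_Icc hM0 hcont
    (show (0 : ℝ) ∈ Set.Icc _ _ from ⟨by simpa using hc.le, hfM⟩)
  refine ⟨x, lt_of_le_of_ne hx.1 ?_, hx0⟩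
  rintro rfl
  norm_num at hx0
  exact hc.ne hx0

/-- For `σ, τ, η > 0`, `α² = π²/2`, `l = 1` and `λ > λ_c`, the characteristic cubic
has a strictly positive real root. -/
theorem stmt_5 (σ τ lam η α : ℝ) (l : ℕ)
    (hσ : 0 < σ) (hτ : 0 < τ) (hη : 0 < η)
    (hα : α ^ 2 = Real.pi ^ 2 / 2) (hl : l = 1)
    (hlam : η / τ + (27 / 4) * Real.pi ^ 4 < lam) :
    ∃ β : ℝ, 0 < β ∧ charCubic σ τ lam η (α ^ 2) l β = 0 := by
  subst hl
  have hπ := Real.pi_pos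
  have hγ : gamSq (α ^ 2) 1 = 3 / 2 * Real.pi ^ 2 := by
    rw [gamSq, hα]; push_cast; ring
  have hlam' : η + 27 / 4 * Real.pi ^ 4 * τ < τ * lam := by
    have h := mul_lt_mul_of_pos_left hlam hτ
    rw [mul_add, mul_div_cancel₀ _ hτ.ne'] at h
    linarith
  have hc : σ * τ * (gamSq (α ^ 2) 1) ^ 3 + σ * α ^ 2 * (η - τ * lam) < 0 := by
    have h : σ * τ * (gamSq (α ^ 2) 1) ^ 3 + σ * α ^ 2 * (η - τ * lam)
        = σ * (Real.pi ^ 2 / 2) * (η + 27 / 4 * Real.pi ^ 4 * τ - τ * lam) := by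
      rw [hγ, hα]; ring
    rw [h]
    exact mul_neg_of_pos_of_neg (by positivity) (by linarith)
  obtain ⟨β, hβ, hroot⟩ := exists_pos_root_cubic ((σ + τ + 1) * gamSq (α ^ 2) 1)
    ((σ + τ + σ * τ) * (gamSq (α ^ 2) 1) ^ 2 - σ * α ^ 2 * (lam - η) / gamSq (α ^ 2) 1)
    _ (by rw [hγ]; positivity) hc
  refine ⟨β, hβ, ?_⟩
  rw [charCubic, add_assoc]
  exact hroot
end

section
/- Assume either (i) σ > 1 > τ > 0 and 0 < η < η_c, or (ii) σ > 1, τ > 1, σ ≠ τ and η > 0. Let α² = π²/2, l = 1 and λ < λ_c. Then every complex root β of the characteristic cubic f satisfies Re β < 0. (This is the stability half of the Principle of Exchange of Stabilities for the critical mode.) -/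
/-- The characteristic cubic, as a polynomial map over `ℂ`. -/
noncomputable def charCubicC (σ τ lam η αsq : ℝ) (l : ℕ) (β : ℂ) : ℂ :=
  β ^ 3 + (((σ + τ + 1) * gamSq αsq l : ℝ) : ℂ) * β ^ 2
    + ((((σ + τ + σ * τ) * (gamSq αsq l) ^ 2
        - σ * αsq * (lam - η) / gamSq αsq l : ℝ)) : ℂ) * β
    + ((σ * τ * (gamSq αsq l) ^ 3 + σ * αsq * (η - τ * lam) : ℝ) : ℂ)

/-- Routh-Hurwitz criterion for a real cubic: `p, r > 0` and `r < p q` force all complex roots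
into the open left half-plane. -/
theorem re_neg_of_cubic_root {p q r : ℝ} (hp : 0 < p) (hr : 0 < r) (hpq : r < p * q) {z : ℂ}
    (hz : z ^ 3 + (p : ℂ) * z ^ 2 + (q : ℂ) * z + (r : ℂ) = 0) : z.re < 0 := by
  have hq : 0 < q := pos_of_mul_pos_right (hr.trans hpq) hp.le
  have hre : z.re ^ 3 - 3 * z.re * z.im ^ 2 + p * (z.re ^ 2 - z.im ^ 2) + q * z.re + r = 0 := by
    have h := congrArg Complex.re hz
    simp [pow_succ] at h
    linarith
  have him : z.im * (3 * z.re ^ 2 - z.im ^ 2 + 2 * p * z.re + q) = 0 := by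
    have h := congrArg Complex.im hz
    simp [pow_succ] at h
    linarith
  by_contra! hu
  rcases mul_eq_zero.1 him with hv | hv
  · rw [hv] at hre
    have : 0 < z.re ^ 3 + p * z.re ^ 2 + q * z.re + r := by positivity
    linarith
  · have hv2 : z.im ^ 2 = 3 * z.re ^ 2 + 2 * p * z.re + q := by linarith
    rw [hv2] at hre
    have : 0 ≤ 8 * z.re ^ 3 + 8 * p * z.re ^ 2 + 2 * q * z.re + 2 * p ^ 2 * z.re := by positivity
    linarith

/-- Stability half of the PES at the critical mode: under regime (i) `σ > 1 > τ > 0`,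
`0 < η < η_c`, or (ii) `σ > 1`, `τ > 1`, `σ ≠ τ`, `η > 0`, with `α² = π²/2`, `l = 1`
and `λ < λ_c`, every complex root of the characteristic cubic has negative real part. -/
theorem stmt_6 (σ τ lam η α : ℝ) (l : ℕ)
    (hcase : (1 < σ ∧ 0 < τ ∧ τ < 1 ∧ 0 < η ∧
        η < (27 / 4) * Real.pi ^ 4 * τ ^ 2 * (1 + σ⁻¹) * (1 - τ)⁻¹) ∨
      (1 < σ ∧ 1 < τ ∧ σ ≠ τ ∧ 0 < η))
    (hα : α ^ 2 = Real.pi ^ 2 / 2) (hl : l = 1)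
    (hlam : lam < η / τ + (27 / 4) * Real.pi ^ 4) :
    ∀ β : ℂ, charCubicC σ τ lam η (α ^ 2) l β = 0 → β.re < 0 := by
  subst hl
  intro β hβ
  have hσ : 0 < σ := by rcases hcase with h | h <;> linarith [h.1]
  have hτ : 0 < τ := by
    rcases hcase with h | h
    · exact h.2.1
    · linarith [h.2.1]
  have hη : σ * η * (1 - τ) < 27 / 4 * Real.pi ^ 4 * (σ + 1) * τ ^ 2 := by
    rcases hcase with ⟨-, -, hτ1, -, h⟩ | ⟨-, hτ1, -, hη⟩
    · have h1 : 0 < 1 - τ := by linarith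
      calc σ * η * (1 - τ)
          < σ * (27 / 4 * Real.pi ^ 4 * τ ^ 2 * (1 + σ⁻¹) * (1 - τ)⁻¹) * (1 - τ) := by gcongr
        _ = 27 / 4 * Real.pi ^ 4 * (σ + 1) * τ ^ 2 := by field_simp
    · have h1 : 0 < σ * η * (τ - 1) := mul_pos (mul_pos hσ hη) (by linarith)
      have h2 : 0 < 27 / 4 * Real.pi ^ 4 * (σ + 1) * τ ^ 2 := by positivity
      linarith
  have hτlam : τ * lam < η + 27 / 4 * Real.pi ^ 4 * τ := by
    calc τ * lam < τ * (η / τ + 27 / 4 * Real.pi ^ 4) := by gcongr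
      _ = η + 27 / 4 * Real.pi ^ 4 * τ := by field_simp
  have hg : gamSq (α ^ 2) 1 = 3 * α ^ 2 := by
    simp only [gamSq, hα]; push_cast; ring
  have hα0 : 0 < α ^ 2 := by rw [hα]; positivity
  have hpi : Real.pi ^ 4 = 4 * (α ^ 2) ^ 2 := by rw [hα]; ring
  rw [charCubicC, hg] at hβ
  rw [hpi] at hη hτlam
  generalize α ^ 2 = x at *
  refine re_neg_of_cubic_root (by positivity) ?_ ?_ hβ
  · have : 0 < σ * x * (η + 27 / 4 * (4 * x ^ 2) * τ - τ * lam) :=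
      mul_pos (by positivity) (by linarith)
    linarith
  · have h1 : 0 < σ * (σ + 1) * x * (η + 27 / 4 * (4 * x ^ 2) * τ - τ * lam) :=
      mul_pos (by positivity) (by linarith)
    have h2 : 0 < (σ + τ + 1) * x * (27 / 4 * (4 * x ^ 2) * (σ + 1) * τ ^ 2 - σ * η * (1 - τ)) :=
      mul_pos (by positivity) (by linarith)
    have hx : σ * x * (lam - η) / (3 * x) = σ * (lam - η) / 3 := by field_simp
    rw [hx, ← sub_pos]
    refine pos_of_mul_pos_right (a := τ) ?_ hτ.le
    linarith
end

section
/- Assume either (i) σ > 1 > τ > 0 and 0 < η < η_c, or (ii) σ > 1, τ > 1, σ ≠ τ and η > 0, and let λ = λ_c. Then for every horizontal wave number α ≥ 0 and every integer l ≥ 1 with (α², l) ≠ (π²/2, 1), every complex root β of the characteristic cubic f (with parameters α, l) satisfies Re β < 0. (This is assertion (4.12) of the Principle of Exchange of Stabilities: all non-critical modes remain strictly stable at criticality.) -/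
/-- Routh–Hurwitz criterion for a real monic cubic: the sufficient direction. -/
theorem re_neg_of_cubic_eq_zero {b c d : ℝ} (hb : 0 < b) (hd : 0 < d) (hbc : d < b * c)
    {β : ℂ} (h : β ^ 3 + (b : ℂ) * β ^ 2 + (c : ℂ) * β + (d : ℂ) = 0) : β.re < 0 := by
  have hc : 0 < c := pos_of_mul_pos_right (hd.trans hbc) hb.le
  obtain ⟨x, y⟩ := β
  have hre := congrArg Complex.re h
  have him := congrArg Complex.im h
  simp only [pow_succ, pow_zero, one_mul, Complex.add_re, Complex.add_im, Complex.mul_re,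
    Complex.mul_im, Complex.ofReal_re, Complex.ofReal_im, Complex.zero_re,
    Complex.zero_im] at hre him
  by_contra! hx
  change 0 ≤ x at hx
  have hpos : 0 ≤ x ^ 3 + b * x ^ 2 + c * x := by positivity
  have hfac : y * (3 * x ^ 2 - y ^ 2 + 2 * b * x + c) = 0 := by linear_combination him
  rcases mul_eq_zero.mp hfac with hy | hy
  · subst hy
    nlinarith
  · have hsum : 8 * x ^ 3 + 8 * b * x ^ 2 + (2 * c + 2 * b ^ 2) * x + (b * c - d) = 0 := by
      linear_combination (3 * x + b) * hy - hre
    have hnn : 0 ≤ 8 * x ^ 3 + 8 * b * x ^ 2 + (2 * c + 2 * b ^ 2) * x := by positivity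
    linarith

theorem gamSq_pos {a : ℝ} (ha : 0 ≤ a) {l : ℕ} (hl : 1 ≤ l) : 0 < gamSq a l := by
  have hl' : (0 : ℝ) < l := by exact_mod_cast hl
  unfold gamSq
  positivity

/-- Away from the critical mode, the neutral curve lies strictly above its minimum. -/
theorem mul_lt_gamSq_pow_three {a : ℝ} (ha : 0 ≤ a) {l : ℕ} (hl : 1 ≤ l)
    (hne : ¬(a = Real.pi ^ 2 / 2 ∧ l = 1)) :
    27 / 4 * Real.pi ^ 4 * a < gamSq a l ^ 3 := by
  have hp : 0 < Real.pi ^ 2 := by positivity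
  have hfac : (a + Real.pi ^ 2) ^ 3 - 27 / 4 * Real.pi ^ 4 * a
      = (a - Real.pi ^ 2 / 2) ^ 2 * (a + 4 * Real.pi ^ 2) := by ring
  rcases hl.eq_or_lt with rfl | hl
  · have ha' : a - Real.pi ^ 2 / 2 ≠ 0 := fun h => hne ⟨sub_eq_zero.mp h, rfl⟩
    have : 0 < (a - Real.pi ^ 2 / 2) ^ 2 * (a + 4 * Real.pi ^ 2) := by positivity
    simp only [gamSq, Nat.cast_one, one_pow, one_mul]
    linarith
  · have hl' : (1 : ℝ) < (l : ℝ) ^ 2 := one_lt_pow₀ (by exact_mod_cast hl) two_ne_zero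
    have hlt : (a + Real.pi ^ 2) ^ 3 < gamSq a l ^ 3 :=
      pow_lt_pow_left₀ (by unfold gamSq; nlinarith) (by positivity) three_ne_zero
    have : 0 ≤ (a - Real.pi ^ 2 / 2) ^ 2 * (a + 4 * Real.pi ^ 2) := by positivity
    linarith

/-- PES assertion (4.12): under regime (i) `σ > 1 > τ > 0`, `0 < η < η_c`, or
(ii) `σ > 1`, `τ > 1`, `σ ≠ τ`, `η > 0`, at `λ = λ_c`, every complex root of the
characteristic cubic of any non-critical mode `(α², l) ≠ (π²/2, 1)` has negative
real part. -/
theorem stmt_7 (σ τ lam η : ℝ)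
    (hcase : (1 < σ ∧ 0 < τ ∧ τ < 1 ∧ 0 < η ∧
        η < (27 / 4) * Real.pi ^ 4 * τ ^ 2 * (1 + σ⁻¹) * (1 - τ)⁻¹) ∨
      (1 < σ ∧ 1 < τ ∧ σ ≠ τ ∧ 0 < η))
    (hlam : lam = η / τ + (27 / 4) * Real.pi ^ 4) :
    ∀ α : ℝ, 0 ≤ α → ∀ l : ℕ, 1 ≤ l → ¬(α ^ 2 = Real.pi ^ 2 / 2 ∧ l = 1) →
      ∀ β : ℂ, charCubicC σ τ lam η (α ^ 2) l β = 0 → β.re < 0 := by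
  intro α _ l hl hne β hβ
  set a := α ^ 2
  have ha : 0 ≤ a := sq_nonneg α
  have hg := gamSq_pos ha hl
  have hcurve := mul_lt_gamSq_pow_three ha hl hne
  have hσ : 0 < σ := by rcases hcase with h | h <;> linarith [h.1]
  have hτ : 0 < τ := by rcases hcase with h | h <;> linarith [h.2.1]
  unfold charCubicC at hβ
  set g := gamSq a l
  set K := 27 / 4 * Real.pi ^ 4
  have hK : 0 < K := by positivity
  have hη : σ * (η / τ * (1 - τ)) ≤ (σ + 1) * τ * K := by
    rcases hcase with ⟨_, _, hτ1, _, hlt⟩ | ⟨_, hτ1, _, hη0⟩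
    · have h1 : 0 < 1 - τ := sub_pos.mpr hτ1
      calc σ * (η / τ * (1 - τ))
          ≤ σ * (K * τ ^ 2 * (1 + σ⁻¹) * (1 - τ)⁻¹ / τ * (1 - τ)) := by gcongr
        _ = (σ + 1) * τ * K := by field_simp
    · have hle : η / τ * (1 - τ) ≤ 0 :=
        mul_nonpos_of_nonneg_of_nonpos (by positivity) (by linarith)
      exact (mul_nonpos_of_nonneg_of_nonpos hσ.le hle).trans (by positivity)
  have hd : σ * τ * g ^ 3 + σ * a * (η - τ * lam) = σ * τ * (g ^ 3 - K * a) := by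
    rw [hlam]
    field_simp
    ring
  refine re_neg_of_cubic_eq_zero (by positivity) ?_ ?_ hβ
  · rw [hd]
    exact mul_pos (by positivity) (sub_pos.mpr hcurve)
  · have hdiff : (σ + τ + 1) * g * ((σ + τ + σ * τ) * g ^ 2 - σ * a * (lam - η) / g)
          - σ * τ * (g ^ 3 - K * a)
        = (σ + τ) * (σ + 1) * (τ + 1) * (g ^ 3 - K * a)
          + (σ + τ + 1) * a * ((σ + 1) * τ * K - σ * (η / τ * (1 - τ))) := by
      rw [hlam]
      field_simp
      ring
    have hpos : 0 < (σ + τ) * (σ + 1) * (τ + 1) * (g ^ 3 - K * a) :=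
      mul_pos (by positivity) (sub_pos.mpr hcurve)
    have hnn : 0 ≤ (σ + τ + 1) * a * ((σ + 1) * τ * K - σ * (η / τ * (1 - τ))) :=
      mul_nonneg (by positivity) (sub_nonneg.mpr hη)
    rw [hd]
    linarith
end

section
/- Fix σ, τ, λ, η with σ, τ > 0 and fix α₁, α₂ > 0. Then for every M > 0 there exists N such that for all (j,k,l) ∈ ℤ² × ℕ with l ≥ 1 and j² + k² + l² > N, every complex root β of the characteristic cubic f_{jkl} satisfies Re β < −M. In particular all roots tend to −∞ as j² + k² + l² → ∞. -/
/-- The characteristic cubic is a perturbation of the product `(β + γ²)(β + σγ²)(β + τγ²)` by a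
polynomial of degree at most one in `β`. -/
lemma charCubicC_eq_prod_sub (σ τ lam η s : ℝ) (l : ℕ) (β : ℂ) :
    charCubicC σ τ lam η s l β =
      (β + gamSq s l) * (β + (σ * gamSq s l : ℝ)) * (β + (τ * gamSq s l : ℝ))
        - ((σ * (lam - η) * (s / gamSq s l) : ℝ) * β - (σ * (η - τ * lam) * s : ℝ)) := by
  simp only [charCubicC]
  push_cast
  ring

lemma le_norm_add_of_neg_le_re {β : ℂ} {M m a G : ℝ} (hG : 0 ≤ G) (hm : m ≤ a)
    (hM : 2 * M ≤ m * G) (hβ : -M ≤ β.re) : m * G / 2 ≤ ‖β + (a * G : ℝ)‖ := by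
  have h := Complex.re_le_norm (β + (a * G : ℝ))
  rw [Complex.add_re, Complex.ofReal_re] at h
  have := mul_le_mul_of_nonneg_right hm hG
  linarith

/-- A root of the characteristic cubic lies to the left of `-M` as soon as `γ²` is large. -/
lemma re_lt_of_charCubicC_eq_zero {σ τ lam η s m M : ℝ} {l : ℕ} {β : ℂ} (hs : 0 ≤ s)
    (hG : 0 < gamSq s l) (hm : 0 < m) (hm1 : m ≤ 1) (hmσ : m ≤ σ) (hmτ : m ≤ τ)
    (hM : 2 * M ≤ m * gamSq s l)
    (hlarge : (m + 2) * |σ * (lam - η)| + 2 * |σ * (η - τ * lam)| < m * (m * gamSq s l / 2) ^ 2)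
    (hβ : charCubicC σ τ lam η s l β = 0) : β.re < -M := by
  by_contra! hre
  rw [charCubicC_eq_prod_sub, sub_eq_zero] at hβ
  have hsG : s ≤ gamSq s l := by
    unfold gamSq
    nlinarith [mul_nonneg (sq_nonneg (l : ℝ)) (sq_nonneg Real.pi)]
  generalize gamSq s l = G at *
  have h1 : m * G / 2 ≤ ‖β + G‖ := by
    simpa using le_norm_add_of_neg_le_re hG.le hm1 hM hre
  have hσ := le_norm_add_of_neg_le_re hG.le hmσ hM hre
  have hτ := le_norm_add_of_neg_le_re hG.le hmτ hM hre
  have hmG : 0 < m * G / 2 := by positivity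
  have hlower : (m * G / 2) ^ 2 * ‖β + G‖ ≤
      ‖(β + G) * (β + (σ * G : ℝ)) * (β + (τ * G : ℝ))‖ := by
    rw [norm_mul, norm_mul]
    calc (m * G / 2) ^ 2 * ‖β + G‖ = ‖β + G‖ * (m * G / 2) * (m * G / 2) := by ring
      _ ≤ _ := by gcongr
  have hupper : ‖((σ * (lam - η) * (s / G) : ℝ) : ℂ) * β - (σ * (η - τ * lam) * s : ℝ)‖ ≤
      |σ * (lam - η)| * ‖β‖ + |σ * (η - τ * lam)| * G := by
    refine (norm_sub_le _ _).trans ?_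
    rw [norm_mul, Complex.norm_real, Complex.norm_real, Real.norm_eq_abs, Real.norm_eq_abs,
      abs_mul _ (s / G), abs_mul _ s, abs_of_nonneg hs, abs_of_nonneg (div_nonneg hs hG.le)]
    have hle : s / G ≤ 1 := (div_le_one hG).2 hsG
    gcongr
    exact mul_le_of_le_one_right (abs_nonneg _) hle
  rw [hβ] at hlower
  have hnorm : ‖β‖ ≤ ‖β + G‖ + G := by
    have h := norm_sub_le (β + G) (G : ℂ)
    rwa [add_sub_cancel_right, Complex.norm_real, Real.norm_of_nonneg hG.le] at h
  have hbound : m * (|σ * (lam - η)| * ‖β‖ + |σ * (η - τ * lam)| * G) ≤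
      ((m + 2) * |σ * (lam - η)| + 2 * |σ * (η - τ * lam)|) * ‖β + G‖ := by
    have hmβ : m * ‖β‖ ≤ (m + 2) * ‖β + G‖ := by
      linarith [mul_le_mul_of_nonneg_left hnorm hm.le]
    have hmG' : m * G ≤ 2 * ‖β + G‖ := by linarith
    linarith [mul_le_mul_of_nonneg_left hmβ (abs_nonneg (σ * (lam - η))),
      mul_le_mul_of_nonneg_left hmG' (abs_nonneg (σ * (η - τ * lam)))]
  have hstrict := mul_lt_mul_of_pos_right hlarge (hmG.trans_le h1)
  linarith [mul_le_mul_of_nonneg_left (hlower.trans hupper) hm.le]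

/-- All roots of the mode cubics `f_{jkl}` tend to `−∞`: for every `M > 0` there is `N`
such that whenever `j² + k² + l² > N` (with `l ≥ 1`), every complex root `β` of
`f_{jkl}` satisfies `Re β < −M`. -/
theorem stmt_9 (σ τ lam η α₁ α₂ : ℝ) (hσ : 0 < σ) (hτ : 0 < τ)
    (hα₁ : 0 < α₁) (hα₂ : 0 < α₂) :
    ∀ M > (0 : ℝ), ∃ N : ℕ, ∀ j k : ℤ, ∀ l : ℕ, 1 ≤ l →
      (N : ℤ) < j ^ 2 + k ^ 2 + (l : ℤ) ^ 2 →
      ∀ β : ℂ,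
        charCubicC σ τ lam η ((j : ℝ) ^ 2 * α₁ ^ 2 + (k : ℝ) ^ 2 * α₂ ^ 2) l β = 0 →
          β.re < -M := by
  intro M _
  obtain ⟨m, hm, hm1, hmσ, hmτ⟩ : ∃ m > 0, m ≤ 1 ∧ m ≤ σ ∧ m ≤ τ :=
    ⟨min 1 (min σ τ), by positivity, by simp, by simp, by simp⟩
  obtain ⟨c, hc, hc₁, hc₂, hcπ⟩ :
      ∃ c > 0, c ≤ α₁ ^ 2 ∧ c ≤ α₂ ^ 2 ∧ c ≤ Real.pi ^ 2 :=
    ⟨min (α₁ ^ 2) (min (α₂ ^ 2) (Real.pi ^ 2)), by positivity, by simp, by simp, by simp⟩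
  have hlin : Filter.Tendsto (fun G : ℝ => m * G) Filter.atTop Filter.atTop :=
    Filter.tendsto_id.const_mul_atTop hm
  have hquad : Filter.Tendsto (fun G : ℝ => m * (m * G / 2) ^ 2) Filter.atTop Filter.atTop :=
    ((Filter.tendsto_pow_atTop two_ne_zero).comp
      (hlin.atTop_div_const two_pos)).const_mul_atTop hm
  obtain ⟨G₀, hG₀⟩ := Filter.eventually_atTop.1 ((Filter.eventually_gt_atTop (0 : ℝ)).and
    ((hlin.eventually_ge_atTop (2 * M)).and (hquad.eventually_gt_atTop
      ((m + 2) * |σ * (lam - η)| + 2 * |σ * (η - τ * lam)|))))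
  obtain ⟨N, hN⟩ := exists_nat_ge (G₀ / c)
  refine ⟨N, fun j k l _ hjkl β hβ => ?_⟩
  have hjkl' : (N : ℝ) < (j : ℝ) ^ 2 + (k : ℝ) ^ 2 + (l : ℝ) ^ 2 := by exact_mod_cast hjkl
  have hG : G₀ ≤ gamSq ((j : ℝ) ^ 2 * α₁ ^ 2 + (k : ℝ) ^ 2 * α₂ ^ 2) l := by
    rw [div_le_iff₀ hc] at hN
    unfold gamSq
    linarith [mul_lt_mul_of_pos_right hjkl' hc,
      mul_le_mul_of_nonneg_left hc₁ (sq_nonneg (j : ℝ)),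
      mul_le_mul_of_nonneg_left hc₂ (sq_nonneg (k : ℝ)),
      mul_le_mul_of_nonneg_left hcπ (sq_nonneg (l : ℝ))]
  obtain ⟨hpos, hM, hlarge⟩ := hG₀ _ hG
  exact re_lt_of_charCubicC_eq_zero (by positivity) hpos hm hm1 hmσ hmτ hM hlarge hβ
end

section
/- Fix 0 < τ < 1 < σ and λ, η ∈ ℝ, and fix α₁, α₂ > 0. Then for all but finitely many (j,k,l) ∈ ℤ² × ℕ (l ≥ 1), the characteristic cubic f_{jkl} has three distinct real roots, all negative. -/
theorem le_gamSq (a : ℝ) (l : ℕ) : a ≤ gamSq a l := by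
  unfold gamSq
  nlinarith [mul_nonneg (sq_nonneg (l : ℝ)) (sq_nonneg Real.pi)]

theorem charCubic_gamSq_mul (σ τ lam η a x : ℝ) {l : ℕ} (hs : gamSq a l ≠ 0) :
    charCubic σ τ lam η a l (gamSq a l * x) =
      gamSq a l ^ 3 * ((x + τ) * (x + 1) * (x + σ)) +
        a * (σ * ((η - lam) * x + (η - τ * lam))) := by
  unfold charCubic
  field_simp
  ring

theorem continuous_charCubic (σ τ lam η a : ℝ) (l : ℕ) :
    Continuous (charCubic σ τ lam η a l) := by
  unfold charCubic
  fun_prop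

theorem abs_lt_mul_pow_three {a s c m : ℝ} (ha : 0 ≤ a) (has : a ≤ s) (hs : 1 ≤ s)
    (hm : 0 < m) (h : |c| / m < s) : |a * c| < s ^ 3 * m := by
  have h₁ : |c| < s * m := (div_lt_iff₀ hm).1 h
  have hs0 : 0 < s := by linarith
  calc |a * c| = a * |c| := by rw [abs_mul, abs_of_nonneg ha]
    _ ≤ s * |c| := by gcongr
    _ < s * (s * m) := by gcongr
    _ = s ^ 2 * m := by ring
    _ ≤ s ^ 3 * m := by gcongr; norm_num

/-- At a point of fixed ratio to `γ²`, the sign of the cubic is eventually that of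
`(x + τ) * (x + 1) * (x + σ)`. -/
theorem exists_charCubic_mul_pos (σ τ lam η x : ℝ)
    (hx : (x + τ) * (x + 1) * (x + σ) ≠ 0) :
    ∃ S : ℝ, ∀ (a : ℝ) (l : ℕ), 0 ≤ a → 1 ≤ l → S < gamSq a l →
      0 < charCubic σ τ lam η a l (gamSq a l * x) * ((x + τ) * (x + 1) * (x + σ)) := by
  set g := (x + τ) * (x + 1) * (x + σ) with hg
  set c := σ * ((η - lam) * x + (η - τ * lam)) with hc
  refine ⟨max 1 (|c| / |g|), fun a l ha hl hS => ?_⟩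
  obtain ⟨h₁, h₂⟩ := max_lt_iff.1 hS
  have hb := abs_lt_mul_pow_three ha (le_gamSq a l) h₁.le (abs_pos.2 hx) h₂
  rw [charCubic_gamSq_mul σ τ lam η a x (gamSq_pos ha hl).ne', ← hg, ← hc]
  obtain ⟨hb₁, hb₂⟩ := abs_lt.1 hb
  rcases lt_or_gt_of_ne hx with h | h
  · rw [abs_of_neg h] at hb₁ hb₂
    exact mul_pos_of_neg_of_neg (by linarith) h
  · rw [abs_of_pos h] at hb₁ hb₂
    exact mul_pos (by linarith) h

theorem exists_three_neg_roots (σ τ lam η : ℝ) (hτ0 : 0 < τ) (hτ1 : τ < 1) (hσ : 1 < σ) :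
    ∃ S : ℝ, ∀ (a : ℝ) (l : ℕ), 0 ≤ a → 1 ≤ l → S < gamSq a l →
      ∃ b₁ b₂ b₃ : ℝ, b₁ < 0 ∧ b₂ < 0 ∧ b₃ < 0 ∧ b₁ ≠ b₂ ∧ b₁ ≠ b₃ ∧ b₂ ≠ b₃ ∧
        charCubic σ τ lam η a l b₁ = 0 ∧ charCubic σ τ lam η a l b₂ = 0 ∧
        charCubic σ τ lam η a l b₃ = 0 := by
  have g₀ : (-(σ + 1) + τ) * (-(σ + 1) + 1) * (-(σ + 1) + σ) < 0 :=
    mul_neg_of_pos_of_neg (mul_pos_of_neg_of_neg (by linarith) (by linarith)) (by linarith)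
  have g₁ : 0 < (-((1 + σ) / 2) + τ) * (-((1 + σ) / 2) + 1) * (-((1 + σ) / 2) + σ) :=
    mul_pos (mul_pos_of_neg_of_neg (by linarith) (by linarith)) (by linarith)
  have g₂ : (-((1 + τ) / 2) + τ) * (-((1 + τ) / 2) + 1) * (-((1 + τ) / 2) + σ) < 0 :=
    mul_neg_of_neg_of_pos (mul_neg_of_neg_of_pos (by linarith) (by linarith)) (by linarith)
  have g₃ : 0 < (0 + τ) * (0 + 1) * (0 + σ) :=
    mul_pos (mul_pos (by linarith) (by linarith)) (by linarith)
  obtain ⟨S₀, h₀⟩ := exists_charCubic_mul_pos σ τ lam η _ g₀.ne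
  obtain ⟨S₁, h₁⟩ := exists_charCubic_mul_pos σ τ lam η _ g₁.ne'
  obtain ⟨S₂, h₂⟩ := exists_charCubic_mul_pos σ τ lam η _ g₂.ne
  obtain ⟨S₃, h₃⟩ := exists_charCubic_mul_pos σ τ lam η _ g₃.ne'
  refine ⟨max (max S₀ S₁) (max S₂ S₃), fun a l ha hl hS => ?_⟩
  simp only [max_lt_iff] at hS
  obtain ⟨⟨hS₀, hS₁⟩, hS₂, hS₃⟩ := hS
  have f₀ := neg_of_mul_pos_left (h₀ a l ha hl hS₀) g₀.le
  have f₁ := pos_of_mul_pos_left (h₁ a l ha hl hS₁) g₁.le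
  have f₂ := neg_of_mul_pos_left (h₂ a l ha hl hS₂) g₂.le
  have f₃ := pos_of_mul_pos_left (h₃ a l ha hl hS₃) g₃.le
  have hs := gamSq_pos ha hl
  have hcont (s : Set ℝ) := (continuous_charCubic σ τ lam η a l).continuousOn (s := s)
  obtain ⟨b₁, ⟨_, hb₁⟩, e₁⟩ := intermediate_value_Ioo
    (mul_le_mul_of_nonneg_left (by linarith) hs.le) (hcont _) ⟨f₀, f₁⟩
  obtain ⟨b₂, ⟨hb₂, hb₂'⟩, e₂⟩ := intermediate_value_Ioo'
    (mul_le_mul_of_nonneg_left (by linarith) hs.le) (hcont _) ⟨f₂, f₁⟩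
  obtain ⟨b₃, ⟨hb₃, hb₃'⟩, e₃⟩ := intermediate_value_Ioo
    (mul_le_mul_of_nonneg_left (by linarith) hs.le) (hcont _) ⟨f₂, f₃⟩
  rw [mul_zero] at hb₃'
  have h₁₂ := hb₁.trans hb₂
  have h₂₃ := hb₂'.trans hb₃
  exact ⟨b₁, b₂, b₃, by linarith, by linarith, hb₃', h₁₂.ne, (h₁₂.trans h₂₃).ne, h₂₃.ne,
    e₁, e₂, e₃⟩

theorem abs_le_ceil_of_sq_mul_le {j : ℤ} {c S : ℝ} (hc : 0 < c) (h : (j : ℝ) ^ 2 * c ≤ S) :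
    |j| ≤ ⌈S / c⌉ := by
  have h₁ : (j : ℝ) ^ 2 ≤ S / c := (le_div_iff₀ hc).2 h
  have h₂ : |j| ≤ j ^ 2 := by
    rw [← sq_abs]
    exact Int.le_self_sq _
  have h₃ : ((j ^ 2 : ℤ) : ℝ) ≤ ⌈S / c⌉ := by
    push_cast
    exact h₁.trans (Int.le_ceil _)
  exact h₂.trans (by exact_mod_cast h₃)

theorem finite_gamSq_le {α₁ α₂ : ℝ} (hα₁ : 0 < α₁) (hα₂ : 0 < α₂) (S : ℝ) :
    {p : ℤ × ℤ × ℕ |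
      gamSq ((p.1 : ℝ) ^ 2 * α₁ ^ 2 + (p.2.1 : ℝ) ^ 2 * α₂ ^ 2) p.2.2 ≤ S}.Finite := by
  refine ((Set.finite_Icc (-⌈S / α₁ ^ 2⌉) ⌈S / α₁ ^ 2⌉).prod
    ((Set.finite_Icc (-⌈S / α₂ ^ 2⌉) ⌈S / α₂ ^ 2⌉).prod
      (Set.finite_Iic ⌈S / Real.pi ^ 2⌉.toNat))).subset ?_
  rintro ⟨j, k, l⟩ h
  simp only [Set.mem_ofPred_eq, gamSq] at h
  have hj : 0 ≤ (j : ℝ) ^ 2 * α₁ ^ 2 := by positivity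
  have hk : 0 ≤ (k : ℝ) ^ 2 * α₂ ^ 2 := by positivity
  have hl : 0 ≤ (l : ℝ) ^ 2 * Real.pi ^ 2 := by positivity
  have hj' := abs_le_ceil_of_sq_mul_le (j := j) (pow_pos hα₁ 2) (S := S) (by linarith)
  have hk' := abs_le_ceil_of_sq_mul_le (j := k) (pow_pos hα₂ 2) (S := S) (by linarith)
  have hl' := abs_le_ceil_of_sq_mul_le (j := (l : ℤ)) (pow_pos Real.pi_pos 2) (S := S)
    (by push_cast; linarith)
  refine ⟨abs_le.1 hj', abs_le.1 hk', ?_⟩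
  have := le_abs_self (l : ℤ)
  simp only [Set.mem_Iic]
  omega

/-- For all but finitely many modes `(j,k,l)` (with `l ≥ 1`), the characteristic cubic
`f_{jkl}` has three distinct real roots, all negative. -/
theorem stmt_10 (σ τ lam η α₁ α₂ : ℝ) (hτ0 : 0 < τ) (hτ1 : τ < 1) (hσ : 1 < σ)
    (hα₁ : 0 < α₁) (hα₂ : 0 < α₂) :
    {p : ℤ × ℤ × ℕ | 1 ≤ p.2.2 ∧
      ¬ ∃ b₁ b₂ b₃ : ℝ, b₁ < 0 ∧ b₂ < 0 ∧ b₃ < 0 ∧ b₁ ≠ b₂ ∧ b₁ ≠ b₃ ∧ b₂ ≠ b₃ ∧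
        charCubic σ τ lam η ((p.1 : ℝ) ^ 2 * α₁ ^ 2 + (p.2.1 : ℝ) ^ 2 * α₂ ^ 2) p.2.2 b₁ = 0 ∧
        charCubic σ τ lam η ((p.1 : ℝ) ^ 2 * α₁ ^ 2 + (p.2.1 : ℝ) ^ 2 * α₂ ^ 2) p.2.2 b₂ = 0 ∧
        charCubic σ τ lam η ((p.1 : ℝ) ^ 2 * α₁ ^ 2 + (p.2.1 : ℝ) ^ 2 * α₂ ^ 2) p.2.2 b₃ = 0}.Finite := by
  obtain ⟨S, hS⟩ := exists_three_neg_roots σ τ lam η hτ0 hτ1 hσ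
  refine (finite_gamSq_le hα₁ hα₂ S).subset ?_
  rintro p ⟨hl, hp⟩
  exact not_lt.1 fun h => hp (hS _ _ (by positivity) hl h)
end

section
/- Let σ, τ > 0, λ, η ∈ ℝ, α₁, α₂ > 0, let j, k ∈ ℤ with j² + k² ≠ 0 and l ≥ 1, and set α² = j²α₁² + k²α₂², γ² = α² + l²π², Θ(x,y) = jα₁x + kα₂y. Let β ∈ ℝ satisfy β + γ² ≠ 0, β + τγ² ≠ 0 and f(β) = 0, where f is the characteristic cubic with these parameters, and set A₁ = 1/(β+γ²), A₂ = 1/(β+τγ²). Then the fields u = (jα₁lπ/α²) cos Θ cos(lπz), v = (kα₂lπ/α²) cos Θ cos(lπz), w = sin Θ sin(lπz), T = A₁ sin Θ sin(lπz), S = A₂ sin Θ sin(lπz), together with the pressure p = −(γ² + β/σ)(lπ/α²) sin Θ cos(lπz), satisfy on ℝ² × [0,1] the linearized system σ(ΔU − ∇p) + σ(λT − ηS)e = βU, ΔT + w = βT, τΔS + w = βS, div U = 0, and moreover w = T = S = 0 and ∂u/∂z = ∂v/∂z = 0 at z = 0 and z = 1. -/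
/-- Partial derivative in `x`. -/
noncomputable def pdx (F : ℝ → ℝ → ℝ → ℝ) (x y z : ℝ) : ℝ := deriv (fun t => F t y z) x
/-- Partial derivative in `y`. -/
noncomputable def pdy (F : ℝ → ℝ → ℝ → ℝ) (x y z : ℝ) : ℝ := deriv (fun t => F x t z) y
/-- Partial derivative in `z`. -/
noncomputable def pdz (F : ℝ → ℝ → ℝ → ℝ) (x y z : ℝ) : ℝ := deriv (fun t => F x y t) z
/-- Laplacian in `(x,y,z)`. -/
noncomputable def lap (F : ℝ → ℝ → ℝ → ℝ) (x y z : ℝ) : ℝ :=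
  pdx (pdx F) x y z + pdy (pdy F) x y z + pdz (pdz F) x y z

theorem pdx_sin (c a b : ℝ) (g : ℝ → ℝ) :
    pdx (fun x y z => c * Real.sin (a * x + b * y) * g z) =
      fun x y z => (c * a) * Real.cos (a * x + b * y) * g z := by
  funext x y z
  have h : HasDerivAt (fun t => a * t + b * y) a x := by
    simpa using ((hasDerivAt_id x).const_mul a).add_const (b * y)
  refine (((h.sin).const_mul c).mul_const (g z)).deriv.trans ?_
  ring

theorem pdx_cos (c a b : ℝ) (g : ℝ → ℝ) :
    pdx (fun x y z => c * Real.cos (a * x + b * y) * g z) =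
      fun x y z => (-c * a) * Real.sin (a * x + b * y) * g z := by
  funext x y z
  have h : HasDerivAt (fun t => a * t + b * y) a x := by
    simpa using ((hasDerivAt_id x).const_mul a).add_const (b * y)
  refine (((h.cos).const_mul c).mul_const (g z)).deriv.trans ?_
  ring

theorem pdy_sin (c a b : ℝ) (g : ℝ → ℝ) :
    pdy (fun x y z => c * Real.sin (a * x + b * y) * g z) =
      fun x y z => (c * b) * Real.cos (a * x + b * y) * g z := by
  funext x y z
  have h : HasDerivAt (fun t => a * x + b * t) b y := by
    simpa using ((hasDerivAt_id y).const_mul b).const_add (a * x)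
  refine (((h.sin).const_mul c).mul_const (g z)).deriv.trans ?_
  ring

theorem pdy_cos (c a b : ℝ) (g : ℝ → ℝ) :
    pdy (fun x y z => c * Real.cos (a * x + b * y) * g z) =
      fun x y z => (-c * b) * Real.sin (a * x + b * y) * g z := by
  funext x y z
  have h : HasDerivAt (fun t => a * x + b * t) b y := by
    simpa using ((hasDerivAt_id y).const_mul b).const_add (a * x)
  refine (((h.cos).const_mul c).mul_const (g z)).deriv.trans ?_
  ring

theorem pdz_sin (c m : ℝ) (h : ℝ → ℝ → ℝ) :
    pdz (fun x y z => c * h x y * Real.sin (m * z)) =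
      fun x y z => (c * m) * h x y * Real.cos (m * z) := by
  funext x y z
  have hm : HasDerivAt (fun t => m * t) m z := by
    simpa using (hasDerivAt_id z).const_mul m
  refine ((hm.sin).const_mul (c * h x y)).deriv.trans ?_
  ring

theorem pdz_cos (c m : ℝ) (h : ℝ → ℝ → ℝ) :
    pdz (fun x y z => c * h x y * Real.cos (m * z)) =
      fun x y z => (-c * m) * h x y * Real.sin (m * z) := by
  funext x y z
  have hm : HasDerivAt (fun t => m * t) m z := by
    simpa using (hasDerivAt_id z).const_mul m
  refine ((hm.cos).const_mul (c * h x y)).deriv.trans ?_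
  ring

theorem lap_sin_sin (c a b m x y z : ℝ) :
    lap (fun x y z => c * Real.sin (a * x + b * y) * Real.sin (m * z)) x y z =
      -(a ^ 2 + b ^ 2 + m ^ 2) * (c * Real.sin (a * x + b * y) * Real.sin (m * z)) := by
  unfold lap
  rw [pdx_sin c a b (fun z => Real.sin (m * z)), pdx_cos _ a b (fun z => Real.sin (m * z)),
    pdy_sin c a b (fun z => Real.sin (m * z)), pdy_cos _ a b (fun z => Real.sin (m * z)),
    pdz_sin c m (fun x y => Real.sin (a * x + b * y)),
    pdz_cos _ m (fun x y => Real.sin (a * x + b * y))]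
  ring

theorem lap_cos_cos (c a b m x y z : ℝ) :
    lap (fun x y z => c * Real.cos (a * x + b * y) * Real.cos (m * z)) x y z =
      -(a ^ 2 + b ^ 2 + m ^ 2) * (c * Real.cos (a * x + b * y) * Real.cos (m * z)) := by
  unfold lap
  rw [pdx_cos c a b (fun z => Real.cos (m * z)), pdx_sin _ a b (fun z => Real.cos (m * z)),
    pdy_cos c a b (fun z => Real.cos (m * z)), pdy_sin _ a b (fun z => Real.cos (m * z)),
    pdz_cos c m (fun x y => Real.cos (a * x + b * y)),
    pdz_sin _ m (fun x y => Real.cos (a * x + b * y))]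
  ring

/-- Lemma 4.7 (real case): the explicit fields built from a real zero `β` of the
characteristic cubic solve the linearized double-diffusive system
`σ(ΔU − ∇p) + σ(λT − ηS)e = βU`, `ΔT + w = βT`, `τΔS + w = βS`, `div U = 0`
on `ℝ² × [0,1]`, with the free-free boundary conditions at `z = 0, 1`. -/
theorem stmt_11 (σ τ lam η α₁ α₂ : ℝ) (j k : ℤ) (l : ℕ)
    (hσ : 0 < σ) (hτ : 0 < τ) (hα₁ : 0 < α₁) (hα₂ : 0 < α₂)
    (hjk : j ^ 2 + k ^ 2 ≠ 0) (hl : 1 ≤ l)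
    (αsq γsq : ℝ)
    (hαsq : αsq = (j : ℝ) ^ 2 * α₁ ^ 2 + (k : ℝ) ^ 2 * α₂ ^ 2)
    (hγsq : γsq = αsq + (l : ℝ) ^ 2 * Real.pi ^ 2)
    (β : ℝ) (hβ1 : β + γsq ≠ 0) (hβ2 : β + τ * γsq ≠ 0)
    (hroot : β ^ 3 + (σ + τ + 1) * γsq * β ^ 2
        + ((σ + τ + σ * τ) * γsq ^ 2 - σ * αsq * (lam - η) / γsq) * β
        + σ * τ * γsq ^ 3 + σ * αsq * (η - τ * lam) = 0)
    (A₁ A₂ : ℝ) (hA₁ : A₁ = 1 / (β + γsq)) (hA₂ : A₂ = 1 / (β + τ * γsq))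
    (u v w T S p : ℝ → ℝ → ℝ → ℝ)
    (hu : u = fun x y z => ((j : ℝ) * α₁ * (l : ℝ) * Real.pi / αsq) *
      Real.cos ((j : ℝ) * α₁ * x + (k : ℝ) * α₂ * y) * Real.cos ((l : ℝ) * Real.pi * z))
    (hv : v = fun x y z => ((k : ℝ) * α₂ * (l : ℝ) * Real.pi / αsq) *
      Real.cos ((j : ℝ) * α₁ * x + (k : ℝ) * α₂ * y) * Real.cos ((l : ℝ) * Real.pi * z))
    (hw : w = fun x y z =>
      Real.sin ((j : ℝ) * α₁ * x + (k : ℝ) * α₂ * y) * Real.sin ((l : ℝ) * Real.pi * z))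
    (hT : T = fun x y z => A₁ *
      Real.sin ((j : ℝ) * α₁ * x + (k : ℝ) * α₂ * y) * Real.sin ((l : ℝ) * Real.pi * z))
    (hS : S = fun x y z => A₂ *
      Real.sin ((j : ℝ) * α₁ * x + (k : ℝ) * α₂ * y) * Real.sin ((l : ℝ) * Real.pi * z))
    (hp : p = fun x y z => -(γsq + β / σ) * ((l : ℝ) * Real.pi / αsq) *
      Real.sin ((j : ℝ) * α₁ * x + (k : ℝ) * α₂ * y) * Real.cos ((l : ℝ) * Real.pi * z)) :
    (∀ x y : ℝ, ∀ z ∈ Set.Icc (0 : ℝ) 1,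
      σ * (lap u x y z - pdx p x y z) = β * u x y z ∧
      σ * (lap v x y z - pdy p x y z) = β * v x y z ∧
      σ * (lap w x y z - pdz p x y z) + σ * (lam * T x y z - η * S x y z) = β * w x y z ∧
      lap T x y z + w x y z = β * T x y z ∧
      τ * lap S x y z + w x y z = β * S x y z ∧
      pdx u x y z + pdy v x y z + pdz w x y z = 0) ∧
    (∀ x y : ℝ,
      w x y 0 = 0 ∧ w x y 1 = 0 ∧ T x y 0 = 0 ∧ T x y 1 = 0 ∧
      S x y 0 = 0 ∧ S x y 1 = 0 ∧
      pdz u x y 0 = 0 ∧ pdz u x y 1 = 0 ∧ pdz v x y 0 = 0 ∧ pdz v x y 1 = 0) := by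
  have hα : αsq ≠ 0 := by
    intro h0
    have h1 : 0 ≤ (j : ℝ) ^ 2 * α₁ ^ 2 := by positivity
    have h2 : 0 ≤ (k : ℝ) ^ 2 * α₂ ^ 2 := by positivity
    have hj : (j : ℝ) ^ 2 * α₁ ^ 2 = 0 := by linarith
    have hk : (k : ℝ) ^ 2 * α₂ ^ 2 = 0 := by linarith
    have hj0 : j = 0 := by simpa [hα₁.ne'] using hj
    have hk0 : k = 0 := by simpa [hα₂.ne'] using hk
    exact hjk (by simp [hj0, hk0])
  have hαpos : 0 < αsq := lt_of_le_of_ne (by rw [hαsq]; positivity) hα.symm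
  have hγ : γsq ≠ 0 := by
    have : 0 ≤ (l : ℝ) ^ 2 * Real.pi ^ 2 := by positivity
    linarith
  replace hw : w = fun x y z => 1 *
      Real.sin ((j : ℝ) * α₁ * x + (k : ℝ) * α₂ * y) * Real.sin ((l : ℝ) * Real.pi * z) := by
    simpa only [one_mul] using hw
  have hm : (l : ℝ) ^ 2 * Real.pi ^ 2 = γsq - αsq := by linarith
  have hlap : ((j : ℝ) * α₁) ^ 2 + ((k : ℝ) * α₂) ^ 2 + ((l : ℝ) * Real.pi) ^ 2 = γsq := by
    rw [hγsq, hαsq]; ring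
  have hT1 : A₁ * (β + γsq) = 1 := by rw [hA₁]; field_simp
  have hS1 : A₂ * (β + τ * γsq) = 1 := by rw [hA₂]; field_simp
  have hchar : (σ * γsq + β) * γsq = σ * αsq * (lam * A₁ - η * A₂) := by
    rw [hA₁, hA₂]
    field_simp at hroot ⊢
    linear_combination hroot
  refine ⟨fun x y z _ => ?_, fun x y => ?_⟩
  · have hux : ∀ c : ℝ, pdx (fun x y z => c *
        Real.cos ((j : ℝ) * α₁ * x + (k : ℝ) * α₂ * y) * Real.cos ((l : ℝ) * Real.pi * z)) = _ :=
      fun c => pdx_cos c _ _ (fun z => Real.cos ((l : ℝ) * Real.pi * z))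
    have hvy : ∀ c : ℝ, pdy (fun x y z => c *
        Real.cos ((j : ℝ) * α₁ * x + (k : ℝ) * α₂ * y) * Real.cos ((l : ℝ) * Real.pi * z)) = _ :=
      fun c => pdy_cos c _ _ (fun z => Real.cos ((l : ℝ) * Real.pi * z))
    have hwz : ∀ c : ℝ, pdz (fun x y z => c *
        Real.sin ((j : ℝ) * α₁ * x + (k : ℝ) * α₂ * y) * Real.sin ((l : ℝ) * Real.pi * z)) = _ :=
      fun c => pdz_sin c _ (fun x y => Real.sin ((j : ℝ) * α₁ * x + (k : ℝ) * α₂ * y))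
    have hpx : ∀ c : ℝ, pdx (fun x y z => c *
        Real.sin ((j : ℝ) * α₁ * x + (k : ℝ) * α₂ * y) * Real.cos ((l : ℝ) * Real.pi * z)) = _ :=
      fun c => pdx_sin c _ _ (fun z => Real.cos ((l : ℝ) * Real.pi * z))
    have hpy : ∀ c : ℝ, pdy (fun x y z => c *
        Real.sin ((j : ℝ) * α₁ * x + (k : ℝ) * α₂ * y) * Real.cos ((l : ℝ) * Real.pi * z)) = _ :=
      fun c => pdy_sin c _ _ (fun z => Real.cos ((l : ℝ) * Real.pi * z))
    have hpz : ∀ c : ℝ, pdz (fun x y z => c *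
        Real.sin ((j : ℝ) * α₁ * x + (k : ℝ) * α₂ * y) * Real.cos ((l : ℝ) * Real.pi * z)) = _ :=
      fun c => pdz_cos c _ (fun x y => Real.sin ((j : ℝ) * α₁ * x + (k : ℝ) * α₂ * y))
    subst hu hv hw hT hS hp
    simp only [lap_sin_sin, lap_cos_cos, hux, hvy, hwz, hpx, hpy, hpz, hlap]
    generalize Real.sin ((j : ℝ) * α₁ * x + (k : ℝ) * α₂ * y) = s
    generalize Real.cos ((j : ℝ) * α₁ * x + (k : ℝ) * α₂ * y) = c
    generalize Real.sin ((l : ℝ) * Real.pi * z) = s'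
    generalize Real.cos ((l : ℝ) * Real.pi * z) = c'
    refine ⟨?_, ?_, ?_, ?_, ?_, ?_⟩
    · field_simp
      ring
    · field_simp
      ring
    · field_simp
      linear_combination (-s * s') * hchar - s * s' * (σ * γsq + β) * hm
    · linear_combination (-s * s') * hT1
    · linear_combination (-s * s') * hS1
    · field_simp
      rw [hαsq]
      ring
  · have huz : ∀ c : ℝ, pdz (fun x y z => c *
        Real.cos ((j : ℝ) * α₁ * x + (k : ℝ) * α₂ * y) * Real.cos ((l : ℝ) * Real.pi * z)) = _ :=
      fun c => pdz_cos c _ (fun x y => Real.cos ((j : ℝ) * α₁ * x + (k : ℝ) * α₂ * y))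
    subst hu hv hw hT hS
    simp [huz, Real.sin_nat_mul_pi]
end

section
/- Let σ, τ > 0, λ, η ∈ ℝ, α₁, α₂ > 0, let j, k ∈ ℤ and l ≥ 0, set α² = j²α₁² + k²α₂², γ² = α² + l²π², Θ(x,y) = jα₁x + kα₂y. Then the fields u = kα₂ cos Θ cos(lπz), v = −jα₁ cos Θ cos(lπz), w = 0, T = 0, S = 0, with pressure p = 0, satisfy on ℝ² × [0,1] the linearized system σ(ΔU − ∇p) + σ(λT − ηS)e = βU, ΔT + w = βT, τΔS + w = βS, div U = 0, with eigenvalue β = −σγ²; moreover ∂u/∂z = ∂v/∂z = 0 at z = 0 and z = 1. -/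
/-- The product of a plane cosine wave in `(x, y)` and a cosine in `z`. -/
noncomputable def cosMode (A a b c : ℝ) : ℝ → ℝ → ℝ → ℝ :=
  fun x y z => A * Real.cos (a * x + b * y) * Real.cos (c * z)

theorem hasDerivAt_cos_affine (a d t : ℝ) :
    HasDerivAt (fun t => Real.cos (a * t + d)) (-(a * Real.sin (a * t + d))) t := by
  have h := (((hasDerivAt_id t).const_mul a).add_const d).cos
  simpa [mul_comm] using h

theorem hasDerivAt_sin_affine (a d t : ℝ) :
    HasDerivAt (fun t => Real.sin (a * t + d)) (a * Real.cos (a * t + d)) t := by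
  have h := (((hasDerivAt_id t).const_mul a).add_const d).sin
  simpa [mul_comm] using h

theorem pdx_cosMode (A a b c : ℝ) :
    pdx (cosMode A a b c) =
      fun x y z => -(A * a) * Real.sin (a * x + b * y) * Real.cos (c * z) := by
  funext x y z
  have h := ((hasDerivAt_cos_affine a (b * y) x).const_mul A).mul_const (Real.cos (c * z))
  exact h.deriv.trans (by ring)

theorem pdy_cosMode (A a b c : ℝ) :
    pdy (cosMode A a b c) =
      fun x y z => -(A * b) * Real.sin (a * x + b * y) * Real.cos (c * z) := by
  funext x y z
  have h := ((hasDerivAt_cos_affine b (a * x) y).const_mul A).mul_const (Real.cos (c * z))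
  simp only [add_comm _ (a * x)] at h
  exact h.deriv.trans (by ring)

theorem pdz_cosMode (A a b c : ℝ) :
    pdz (cosMode A a b c) =
      fun x y z => -(A * c) * Real.cos (a * x + b * y) * Real.sin (c * z) := by
  funext x y z
  have h := (hasDerivAt_cos_affine c 0 z).const_mul (A * Real.cos (a * x + b * y))
  simp only [add_zero] at h
  exact h.deriv.trans (by ring)

theorem lap_cosMode (A a b c x y z : ℝ) :
    lap (cosMode A a b c) x y z = -(a ^ 2 + b ^ 2 + c ^ 2) * cosMode A a b c x y z := by
  have hx := ((hasDerivAt_sin_affine a (b * y) x).const_mul (-(A * a))).mul_const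
    (Real.cos (c * z))
  have hy := ((hasDerivAt_sin_affine b (a * x) y).const_mul (-(A * b))).mul_const
    (Real.cos (c * z))
  have hz := (hasDerivAt_sin_affine c 0 z).const_mul (-(A * c) * Real.cos (a * x + b * y))
  simp only [add_comm _ (a * x)] at hy
  simp only [add_zero] at hz
  rw [lap, pdx_cosMode, pdy_cosMode, pdz_cosMode, pdx, pdy, pdz, hx.deriv, hy.deriv, hz.deriv,
    cosMode]
  ring

theorem pdx_zero : pdx (fun _ _ _ => 0) = fun _ _ _ => 0 := by
  funext x y z
  simp [pdx]

theorem pdy_zero : pdy (fun _ _ _ => 0) = fun _ _ _ => 0 := by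
  funext x y z
  simp [pdy]

theorem pdz_zero : pdz (fun _ _ _ => 0) = fun _ _ _ => 0 := by
  funext x y z
  simp [pdz]

theorem lap_zero (x y z : ℝ) : lap (fun _ _ _ => 0) x y z = 0 := by
  simp [lap, pdx_zero, pdy_zero, pdz_zero]

/-- Lemma 4.2: the purely horizontal field with zero vertical velocity, temperature
and salinity solves the linearized double-diffusive system with eigenvalue
`β = −σγ²`, where `γ² = j²α₁² + k²α₂² + l²π²`, and satisfies the free-free
boundary conditions at `z = 0, 1`. -/
theorem stmt_12 (σ τ lam η α₁ α₂ : ℝ) (j k : ℤ) (l : ℕ)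
    (hσ : 0 < σ) (hτ : 0 < τ) (hα₁ : 0 < α₁) (hα₂ : 0 < α₂)
    (αsq γsq β : ℝ)
    (hαsq : αsq = (j : ℝ) ^ 2 * α₁ ^ 2 + (k : ℝ) ^ 2 * α₂ ^ 2)
    (hγsq : γsq = αsq + (l : ℝ) ^ 2 * Real.pi ^ 2)
    (hβ : β = -σ * γsq)
    (u v w T S p : ℝ → ℝ → ℝ → ℝ)
    (hu : u = fun x y z => (k : ℝ) * α₂ *
      Real.cos ((j : ℝ) * α₁ * x + (k : ℝ) * α₂ * y) * Real.cos ((l : ℝ) * Real.pi * z))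
    (hv : v = fun x y z => -((j : ℝ) * α₁) *
      Real.cos ((j : ℝ) * α₁ * x + (k : ℝ) * α₂ * y) * Real.cos ((l : ℝ) * Real.pi * z))
    (hw : w = fun _ _ _ => 0) (hT : T = fun _ _ _ => 0) (hS : S = fun _ _ _ => 0)
    (hp : p = fun _ _ _ => 0) :
    (∀ x y : ℝ, ∀ z ∈ Set.Icc (0 : ℝ) 1,
      σ * (lap u x y z - pdx p x y z) = β * u x y z ∧
      σ * (lap v x y z - pdy p x y z) = β * v x y z ∧
      σ * (lap w x y z - pdz p x y z) + σ * (lam * T x y z - η * S x y z) = β * w x y z ∧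
      lap T x y z + w x y z = β * T x y z ∧
      τ * lap S x y z + w x y z = β * S x y z ∧
      pdx u x y z + pdy v x y z + pdz w x y z = 0) ∧
    (∀ x y : ℝ,
      pdz u x y 0 = 0 ∧ pdz u x y 1 = 0 ∧ pdz v x y 0 = 0 ∧ pdz v x y 1 = 0) := by
  replace hu : u = cosMode (k * α₂) (j * α₁) (k * α₂) (l * Real.pi) := hu
  replace hv : v = cosMode (-(j * α₁)) (j * α₁) (k * α₂) (l * Real.pi) := hv
  subst hu hv hw hT hS hp hβ hγsq hαsq
  refine ⟨fun x y z _ => ⟨?_, ?_, ?_, ?_, ?_, ?_⟩, fun x y => ?_⟩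
  · rw [lap_cosMode, pdx_zero]
    ring
  · rw [lap_cosMode, pdy_zero]
    ring
  · simp [lap_zero, pdz_zero]
  · simp [lap_zero]
  · simp [lap_zero]
  · rw [pdx_cosMode, pdy_cosMode, pdz_zero]
    ring
  · simp [pdz_cosMode, Real.sin_nat_mul_pi]
end

section
/- Let σ > 0, 0 < τ < 1 and 0 < η < η_c. Set λ_c = η/τ + (27/4)π⁴, a = 4σλ_c/(9π⁴), b = −4ση/(9π⁴τ²), and δ₁ = −(a + τ⁻¹ b) / (8(3 + a + b)). Then 3 + a + b > 0, and: δ₁ < 0 if η < η_{c1}, while δ₁ > 0 if η_{c1} < η < η_c, where η_{c1} = (27/4)π⁴τ³(1−τ²)⁻¹ and η_c = (27/4)π⁴τ²(1+σ⁻¹)(1−τ)⁻¹. -/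
/-- Sign of the cubic coefficient `δ₁` of the center-manifold reduced equations:
with `a = 4σλ_c/(9π⁴)`, `b = −4ση/(9π⁴τ²)` and `δ₁ = −(a + τ⁻¹b)/(8(3+a+b))`,
one has `3 + a + b > 0`, and `δ₁ < 0` if `η < η_{c₁}` while `δ₁ > 0` if
`η_{c₁} < η < η_c`. -/
theorem stmt_14 (σ τ η a b δ₁ : ℝ) (hσ : 0 < σ) (hτ0 : 0 < τ) (hτ1 : τ < 1)
    (hη0 : 0 < η)
    (hηc : η < (27 / 4) * Real.pi ^ 4 * τ ^ 2 * (1 + σ⁻¹) * (1 - τ)⁻¹)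
    (ha : a = 4 * σ * (η / τ + (27 / 4) * Real.pi ^ 4) / (9 * Real.pi ^ 4))
    (hb : b = -(4 * σ * η) / (9 * Real.pi ^ 4 * τ ^ 2))
    (hδ₁ : δ₁ = -(a + τ⁻¹ * b) / (8 * (3 + a + b))) :
    0 < 3 + a + b ∧
    (η < (27 / 4) * Real.pi ^ 4 * τ ^ 3 * (1 - τ ^ 2)⁻¹ → δ₁ < 0) ∧
    ((27 / 4) * Real.pi ^ 4 * τ ^ 3 * (1 - τ ^ 2)⁻¹ < η → 0 < δ₁) := by
  have hπ := Real.pi_pos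
  have h1τ : 0 < 1 - τ := by linarith
  have h1τ2 : 0 < 1 - τ ^ 2 := by nlinarith
  have hden : 3 + a + b = 4 * σ * (1 - τ) / (9 * Real.pi ^ 4 * τ ^ 2) *
      ((27 / 4) * Real.pi ^ 4 * τ ^ 2 * (1 + σ⁻¹) * (1 - τ)⁻¹ - η) := by
    rw [ha, hb]
    field_simp
    ring
  have hnum : a + τ⁻¹ * b = 4 * σ * (1 - τ ^ 2) / (9 * Real.pi ^ 4 * τ ^ 3) *
      ((27 / 4) * Real.pi ^ 4 * τ ^ 3 * (1 - τ ^ 2)⁻¹ - η) := by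
    rw [ha, hb]
    field_simp
    ring
  have hpos : 0 < 3 + a + b := hden ▸ mul_pos (by positivity) (sub_pos.2 hηc)
  have hcoef : 0 < 4 * σ * (1 - τ ^ 2) / (9 * Real.pi ^ 4 * τ ^ 3) := by positivity
  refine ⟨hpos, fun h => ?_, fun h => ?_⟩
  · have hN := mul_pos hcoef (sub_pos.2 h)
    rw [← hnum] at hN
    exact hδ₁ ▸ div_neg_of_neg_of_pos (neg_neg_of_pos hN) (by positivity)
  · have hN := mul_neg_of_pos_of_neg hcoef (sub_neg.2 h)
    rw [← hnum] at hN
    exact hδ₁ ▸ div_pos (neg_pos.2 hN) (by positivity)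
end

section
/- Let δ₁ < 0 and δ₂ ∈ ℝ satisfy 2δ₁ + δ₂ < 0. Let (x₁, y₁, x₂, y₂) : [0, ∞) → ℝ⁴ be differentiable and solve x₁′ = δ₁E x₁ + δ₂ r₂² x₁, y₁′ = δ₁E y₁ + δ₂ r₂² y₁, x₂′ = δ₁E x₂ + δ₂ r₁² x₂, y₂′ = δ₁E y₂ + δ₂ r₁² y₂, where r₁² = x₁² + y₁², r₂² = x₂² + y₂², and E = r₁² + r₂². Then E(t) → 0 as t → ∞; i.e. every solution converges to the origin. -/
open Filter

/-- A nonnegative function satisfying the Riccati differential inequality `f' ≤ -c f²` with `c > 0`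
on `[0, ∞)` tends to `0` at infinity. -/
theorem tendsto_zero_of_hasDerivAt_le_neg_mul_sq {f f' : ℝ → ℝ} {c : ℝ} (hc : 0 < c)
    (hf : ∀ t ≥ (0 : ℝ), HasDerivAt f (f' t) t) (hf₀ : ∀ t ≥ (0 : ℝ), 0 ≤ f t)
    (hf' : ∀ t ≥ (0 : ℝ), f' t ≤ -c * f t ^ 2) : Tendsto f atTop (nhds 0) := by
  have hcont : ContinuousOn f (Set.Ici 0) := fun t ht => (hf t ht).continuousAt.continuousWithinAt
  have hanti : AntitoneOn f (Set.Ici 0) := by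
    refine antitoneOn_of_deriv_nonpos (convex_Ici 0) hcont
      (fun t ht => (hf t (interior_subset ht)).differentiableAt.differentiableWithinAt)
      (fun t ht => ?_)
    rw [(hf t (interior_subset ht)).deriv]
    nlinarith [hf' t (interior_subset ht), mul_nonneg hc.le (sq_nonneg (f t))]
  have hbound : ∀ t ≥ (0 : ℝ), c * f t ^ 2 * t ≤ f 0 := by
    intro t ht
    have h := Convex.image_sub_le_mul_sub_of_deriv_le (convex_Icc 0 t) (f := f)
      (C := -c * f t ^ 2) (hcont.mono fun s hs => hs.1)
      (fun s hs => (hf s (interior_subset hs).1).differentiableAt.differentiableWithinAt)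
      (fun s hs => ?_) 0 ⟨le_rfl, ht⟩ t ⟨ht, le_rfl⟩ ht
    · linarith [hf₀ t ht]
    · have hs' := interior_subset hs
      rw [(hf s hs'.1).deriv]
      have hle : f t ^ 2 ≤ f s ^ 2 := pow_le_pow_left₀ (hf₀ t ht) (hanti hs'.1 ht hs'.2) 2
      nlinarith [hf' s hs'.1, mul_le_mul_of_nonneg_left hle hc.le]
  rw [Metric.tendsto_atTop]
  intro ε hε
  refine ⟨f 0 / (c * ε ^ 2) + 1, fun t ht => ?_⟩
  have hpos : 0 < c * ε ^ 2 := by positivity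
  have ht₀ : 0 ≤ t := le_trans (add_nonneg (div_nonneg (hf₀ 0 le_rfl) hpos.le) zero_le_one) ht
  rw [Real.dist_eq, sub_zero, abs_of_nonneg (hf₀ t ht₀)]
  by_contra! hle
  have hlt : f 0 < t * (c * ε ^ 2) := (div_lt_iff₀ hpos).mp (by linarith)
  have hsq : c * ε ^ 2 * t ≤ c * f t ^ 2 * t := by gcongr
  linarith [hbound t ht₀]

/-- The truncated reduced system of the square case at criticality: if `δ₁ < 0` and
`2δ₁ + δ₂ < 0` (negative definiteness of `δ₁E² + 2δ₂r₁²r₂²`), then the energy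
`E = x₁² + y₁² + x₂² + y₂²` of every solution tends to `0`. -/
theorem stmt_17 (δ₁ δ₂ : ℝ) (hδ₁ : δ₁ < 0) (hδ : 2 * δ₁ + δ₂ < 0)
    (x₁ y₁ x₂ y₂ : ℝ → ℝ)
    (hx₁ : ∀ t ≥ (0 : ℝ), HasDerivAt x₁
      (δ₁ * (x₁ t ^ 2 + y₁ t ^ 2 + x₂ t ^ 2 + y₂ t ^ 2) * x₁ t
        + δ₂ * (x₂ t ^ 2 + y₂ t ^ 2) * x₁ t) t)
    (hy₁ : ∀ t ≥ (0 : ℝ), HasDerivAt y₁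
      (δ₁ * (x₁ t ^ 2 + y₁ t ^ 2 + x₂ t ^ 2 + y₂ t ^ 2) * y₁ t
        + δ₂ * (x₂ t ^ 2 + y₂ t ^ 2) * y₁ t) t)
    (hx₂ : ∀ t ≥ (0 : ℝ), HasDerivAt x₂
      (δ₁ * (x₁ t ^ 2 + y₁ t ^ 2 + x₂ t ^ 2 + y₂ t ^ 2) * x₂ t
        + δ₂ * (x₁ t ^ 2 + y₁ t ^ 2) * x₂ t) t)
    (hy₂ : ∀ t ≥ (0 : ℝ), HasDerivAt y₂
      (δ₁ * (x₁ t ^ 2 + y₁ t ^ 2 + x₂ t ^ 2 + y₂ t ^ 2) * y₂ t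
        + δ₂ * (x₁ t ^ 2 + y₁ t ^ 2) * y₂ t) t) :
    Tendsto (fun t => x₁ t ^ 2 + y₁ t ^ 2 + x₂ t ^ 2 + y₂ t ^ 2) atTop (nhds 0) := by
  refine tendsto_zero_of_hasDerivAt_le_neg_mul_sq (c := min (-(2 * δ₁)) (-(2 * δ₁ + δ₂)))
    (lt_min (by linarith) (by linarith))
    (fun t ht => ((((hx₁ t ht).pow 2).add ((hy₁ t ht).pow 2)).add ((hx₂ t ht).pow 2)).add
      ((hy₂ t ht).pow 2)) (fun t _ => by positivity) (fun t _ => ?_)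
  set a := x₁ t ^ 2 + y₁ t ^ 2 with ha
  set b := x₂ t ^ 2 + y₂ t ^ 2 with hb
  have hab : 0 ≤ a * b := by positivity
  have hE : x₁ t ^ 2 + y₁ t ^ 2 + x₂ t ^ 2 + y₂ t ^ 2 = a + b := by rw [ha, hb]; ring
  have key : 2 * δ₁ * (a + b) ^ 2 + 4 * δ₂ * (a * b)
      ≤ -min (-(2 * δ₁)) (-(2 * δ₁ + δ₂)) * (a + b) ^ 2 := by
    rcases le_total δ₂ 0 with h | h
    · rw [min_eq_left (by linarith)]
      nlinarith [mul_nonneg (neg_nonneg.mpr h) hab]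
    · rw [min_eq_right (by linarith)]
      nlinarith [mul_nonneg h (sq_nonneg (a - b))]
  have hE' : a + x₂ t ^ 2 + y₂ t ^ 2 = a + b := by rw [hb]; ring
  rw [hE']
  refine le_of_eq_of_le ?_ key
  simp only [ha, hb]
  push_cast
  ring
end

section
/- Assume σ > 1 > τ > 0, 0 < η < η_c, α² = π²/2, l = 1 and λ = λ_c. Then the roots of the characteristic cubic f are exactly 0 together with two distinct strictly negative real numbers. -/
/-- A monic cubic without constant term whose quadratic factor has positive coefficients and
positive discriminant has exactly the roots `0` and two distinct negative reals. -/
theorem exists_neg_roots_of_cubic {b c : ℝ} (hb : 0 < b) (hc : 0 < c) (hd : 4 * c < b ^ 2) :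
    ∃ b₂ b₃ : ℝ, b₂ < 0 ∧ b₃ < 0 ∧ b₂ ≠ b₃ ∧
      ∀ β : ℂ, β ^ 3 + (b : ℂ) * β ^ 2 + (c : ℂ) * β = 0 ↔
        (β = 0 ∨ β = (b₂ : ℂ) ∨ β = (b₃ : ℂ)) := by
  have hpos : 0 < b ^ 2 - 4 * c := by linarith
  have hs := Real.sq_sqrt hpos.le
  have hs0 := Real.sqrt_pos.mpr hpos
  set s := Real.sqrt (b ^ 2 - 4 * c)
  have hsb : s < b := by nlinarith
  refine ⟨(-b + s) / 2, (-b - s) / 2, by linarith, by linarith, fun h => by linarith,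
    fun β => ?_⟩
  have hsC : (s : ℂ) ^ 2 = (b : ℂ) ^ 2 - 4 * c := by exact_mod_cast hs
  have hfac : β ^ 3 + (b : ℂ) * β ^ 2 + (c : ℂ) * β =
      β * ((β - (((-b + s) / 2 : ℝ) : ℂ)) * (β - (((-b - s) / 2 : ℝ) : ℂ))) := by
    push_cast
    linear_combination (β / 4) * hsC
  rw [hfac, mul_eq_zero, mul_eq_zero, sub_eq_zero, sub_eq_zero]

/-- For `σ > 1 > τ > 0`, `0 < η < η_c`, `α² = π²/2`, `l = 1` and `λ = λ_c`, the roots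
of the characteristic cubic are exactly `0` together with two distinct strictly
negative real numbers. -/
theorem stmt_18 (σ τ lam η α : ℝ) (l : ℕ)
    (hσ : 1 < σ) (hτ0 : 0 < τ) (hτ1 : τ < 1)
    (hη0 : 0 < η)
    (hηc : η < (27 / 4) * Real.pi ^ 4 * τ ^ 2 * (1 + σ⁻¹) * (1 - τ)⁻¹)
    (hα : α ^ 2 = Real.pi ^ 2 / 2) (hl : l = 1)
    (hlam : lam = η / τ + (27 / 4) * Real.pi ^ 4) :
    ∃ b₂ b₃ : ℝ, b₂ < 0 ∧ b₃ < 0 ∧ b₂ ≠ b₃ ∧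
      ∀ β : ℂ, charCubicC σ τ lam η (α ^ 2) l β = 0 ↔
        (β = 0 ∨ β = (b₂ : ℂ) ∨ β = (b₃ : ℂ)) := by
  subst hl hlam
  have hσ0 : 0 < σ := by linarith
  have hτ' : 0 < 1 - τ := by linarith
  obtain ⟨g, hg⟩ : ∃ g, g = 3 * Real.pi ^ 2 / 2 := ⟨_, rfl⟩
  have hg0 : 0 < g := by rw [hg]; positivity
  have hpi : Real.pi ^ 2 = 2 * g / 3 := by linarith
  have hpi4 : Real.pi ^ 4 = 4 * g ^ 2 / 9 := by
    linear_combination (Real.pi ^ 2 + 2 * g / 3) * hpi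
  have hα' : α ^ 2 = g / 3 := by linarith
  have hgam : gamSq (g / 3) 1 = g := by
    rw [gamSq, hpi]; push_cast; ring
  have hlin : (σ + τ + σ * τ) * g ^ 2
        - σ * (g / 3) * (η / τ + 27 / 4 * (4 * g ^ 2 / 9) - η) / g
      = τ * (1 + σ) * g ^ 2 - σ * (1 - τ) * η / (3 * τ) := by
    field_simp
    ring
  have hconst : σ * τ * g ^ 3 + σ * (g / 3) * (η - τ * (η / τ + 27 / 4 * (4 * g ^ 2 / 9))) = 0 := by
    field_simp
    ring
  have hdrop : 0 < σ * (1 - τ) * η / (3 * τ) := by positivity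
  have hc : 0 < τ * (1 + σ) * g ^ 2 - σ * (1 - τ) * η / (3 * τ) := by
    have hbound : 27 / 4 * Real.pi ^ 4 * τ ^ 2 * (1 + σ⁻¹) * (1 - τ)⁻¹
        = 3 * τ * (τ * (1 + σ) * g ^ 2) / (σ * (1 - τ)) := by
      rw [hpi4]
      field_simp
      ring
    rw [hbound, lt_div_iff₀ (by positivity)] at hηc
    rw [sub_pos, div_lt_iff₀ (by positivity)]
    linarith
  have hd : 4 * (τ * (1 + σ) * g ^ 2 - σ * (1 - τ) * η / (3 * τ))
      < ((σ + τ + 1) * g) ^ 2 := by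
    nlinarith [sq_nonneg ((σ + 1 - τ) * g)]
  simpa only [charCubicC, hgam, hα', hpi4, hlin, hconst, Complex.ofReal_zero, add_zero] using
    exists_neg_roots_of_cubic (by positivity : 0 < (σ + τ + 1) * g) hc hd
end
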